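/- arXiv:1307.1588 — 4 statements merged into one kernel-verified Lean document; each statement's English description precedes it below -/
import Mathlib

section
/- Let H₁, H₂ be complex Hilbert spaces and let Q be a bounded operator on the Hilbert space direct sum H₁ ⊕ H₂ with block decomposition Q = [[Q₁₁, Q₁₂], [Q₂₁, Q₂₂]] (Q_{ij} : H_j → H_i). Suppose ‖Q‖ ≤ r for some r with 0 ≤ r < 1, and let X be a bounded operator on H₂ with ‖X‖ ≤ 1. Then 1 − Q₂₂X is invertible in the bounded operators on H₂, and the upper linear fractional transform satisfies ‖Q₁₁ + Q₁₂·X·(1 − Q₂₂X)⁻¹·Q₂₁‖ ≤ r. -/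
/-- The norm bound for a block operator on an `ℓ²` direct sum, in coordinates. -/
theorem block_norm_sq_le {H₁ H₂ : Type*}
    [NormedAddCommGroup H₁] [InnerProductSpace ℂ H₁]
    [NormedAddCommGroup H₂] [InnerProductSpace ℂ H₂]
    {Q : WithLp 2 (H₁ × H₂) →L[ℂ] WithLp 2 (H₁ × H₂)}
    {Q₁₁ : H₁ →L[ℂ] H₁} {Q₁₂ : H₂ →L[ℂ] H₁} {Q₂₁ : H₁ →L[ℂ] H₂} {Q₂₂ : H₂ →L[ℂ] H₂}
    (hQ : ∀ x : WithLp 2 (H₁ × H₂),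
      WithLp.equiv 2 (H₁ × H₂) (Q x) =
        (Q₁₁ (WithLp.equiv 2 (H₁ × H₂) x).1 + Q₁₂ (WithLp.equiv 2 (H₁ × H₂) x).2,
         Q₂₁ (WithLp.equiv 2 (H₁ × H₂) x).1 + Q₂₂ (WithLp.equiv 2 (H₁ × H₂) x).2))
    {r : ℝ} (hQr : ‖Q‖ ≤ r) (a : H₁) (b : H₂) :
    ‖Q₁₁ a + Q₁₂ b‖ ^ 2 + ‖Q₂₁ a + Q₂₂ b‖ ^ 2 ≤ r ^ 2 * (‖a‖ ^ 2 + ‖b‖ ^ 2) := by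
  have hx := hQ (WithLp.toLp 2 (a, b))
  have h₁ : (Q (WithLp.toLp 2 (a, b))).fst = Q₁₁ a + Q₁₂ b := congrArg Prod.fst hx
  have h₂ : (Q (WithLp.toLp 2 (a, b))).snd = Q₂₁ a + Q₂₂ b := congrArg Prod.snd hx
  have hn := pow_le_pow_left₀ (norm_nonneg _) (Q.le_of_opNorm_le hQr (WithLp.toLp 2 (a, b))) 2
  rw [mul_pow, WithLp.prod_norm_sq_eq_of_L2, WithLp.prod_norm_sq_eq_of_L2, h₁, h₂] at hn
  exact hn

/-- If `Q = [[Q₁₁,Q₁₂],[Q₂₁,Q₂₂]]` is a bounded operator on the Hilbert-space direct sum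
`H₁ ⊕ H₂` with `‖Q‖ ≤ r < 1`, and `X` is a bounded operator on `H₂` with `‖X‖ ≤ 1`,
then `1 − Q₂₂X` is invertible and `‖Q₁₁ + Q₁₂ X (1 − Q₂₂X)⁻¹ Q₂₁‖ ≤ r`. -/
theorem stmt_4 (H₁ H₂ : Type*)
    [NormedAddCommGroup H₁] [InnerProductSpace ℂ H₁] [CompleteSpace H₁]
    [NormedAddCommGroup H₂] [InnerProductSpace ℂ H₂] [CompleteSpace H₂]
    (Q : WithLp 2 (H₁ × H₂) →L[ℂ] WithLp 2 (H₁ × H₂))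
    (Q₁₁ : H₁ →L[ℂ] H₁) (Q₁₂ : H₂ →L[ℂ] H₁) (Q₂₁ : H₁ →L[ℂ] H₂) (Q₂₂ : H₂ →L[ℂ] H₂)
    (hQ : ∀ x : WithLp 2 (H₁ × H₂),
      WithLp.equiv 2 (H₁ × H₂) (Q x) =
        (Q₁₁ (WithLp.equiv 2 (H₁ × H₂) x).1 + Q₁₂ (WithLp.equiv 2 (H₁ × H₂) x).2,
         Q₂₁ (WithLp.equiv 2 (H₁ × H₂) x).1 + Q₂₂ (WithLp.equiv 2 (H₁ × H₂) x).2))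
    (r : ℝ) (hr0 : 0 ≤ r) (hr1 : r < 1) (hQr : ‖Q‖ ≤ r)
    (X : H₂ →L[ℂ] H₂) (hX : ‖X‖ ≤ 1) :
    IsUnit (1 - Q₂₂.comp X) ∧
      ‖Q₁₁ + Q₁₂.comp (X.comp ((Ring.inverse (1 - Q₂₂.comp X)).comp Q₂₁))‖ ≤ r := by
  have hb := block_norm_sq_le hQ hQr
  have h₂₂ : ‖Q₂₂‖ ≤ r := by
    refine Q₂₂.opNorm_le_bound hr0 fun b => ?_
    have h := hb 0 b
    simp only [map_zero, zero_add, norm_zero] at h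
    refine (pow_le_pow_iff_left₀ (norm_nonneg _) (by positivity) two_ne_zero).1 ?_
    nlinarith [sq_nonneg ‖Q₁₂ b‖]
  have hlt : ‖Q₂₂.comp X‖ < 1 := by
    refine lt_of_le_of_lt (Q₂₂.opNorm_comp_le X) ?_
    nlinarith [norm_nonneg Q₂₂, norm_nonneg X]
  have hu : IsUnit (1 - Q₂₂.comp X) := isUnit_one_sub_of_norm_lt_one hlt
  refine ⟨hu, ContinuousLinearMap.opNorm_le_bound _ hr0 fun a => ?_⟩
  simp only [add_apply, ContinuousLinearMap.comp_apply]
  set w := Ring.inverse (1 - Q₂₂.comp X) (Q₂₁ a) with hw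
  have hfix : Q₂₁ a + Q₂₂ (X w) = w := by
    have h := congrArg (fun T : H₂ →L[ℂ] H₂ => T (Q₂₁ a)) (Ring.mul_inverse_cancel _ hu)
    simp only [mul_apply_eq_comp, sub_apply, one_apply_eq_self, ContinuousLinearMap.comp_apply, ← hw] at h
    rw [← h, sub_add_cancel]
  have hXw : ‖X w‖ ≤ ‖w‖ := by simpa using X.le_of_opNorm_le hX w
  have h := hb a (X w)
  rw [hfix] at h
  have hXw2 : ‖X w‖ ^ 2 ≤ ‖w‖ ^ 2 := pow_le_pow_left₀ (norm_nonneg _) hXw 2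
  have hr2 : r ^ 2 ≤ 1 := pow_le_one₀ hr0 hr1.le
  refine (pow_le_pow_iff_left₀ (norm_nonneg _) (by positivity) two_ne_zero).1 ?_
  nlinarith [mul_le_mul_of_nonneg_left hXw2 (sq_nonneg r),
    mul_le_mul_of_nonneg_right hr2 (sq_nonneg ‖w‖)]
end

section
/- Let K₁, K₂ be complex Hilbert spaces and let p be a bounded operator on K₁ ⊕ K₂ with block decomposition p = [[p₁₁, p₁₂], [p₂₁, p₂₂]] and ‖p‖ ≤ 1. Let X be a bounded operator on K₂ with ‖X‖ < 1. Then 1 − p₂₂X is invertible in the bounded operators on K₂ and ‖p₁₁ + p₁₂·X·(1 − p₂₂X)⁻¹·p₂₁‖ ≤ 1. -/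
/-- A contraction on `K₁ ⊕ K₂` given by a block matrix does not increase the sum of the squared
norms of the components. -/
theorem block_contraction_norm_sq_le {K₁ K₂ : Type*}
    [NormedAddCommGroup K₁] [InnerProductSpace ℂ K₁]
    [NormedAddCommGroup K₂] [InnerProductSpace ℂ K₂]
    {p : WithLp 2 (K₁ × K₂) →L[ℂ] WithLp 2 (K₁ × K₂)}
    {p₁₁ : K₁ →L[ℂ] K₁} {p₁₂ : K₂ →L[ℂ] K₁} {p₂₁ : K₁ →L[ℂ] K₂} {p₂₂ : K₂ →L[ℂ] K₂}
    (hp : ∀ x : WithLp 2 (K₁ × K₂),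
      WithLp.equiv 2 (K₁ × K₂) (p x) =
        (p₁₁ (WithLp.equiv 2 (K₁ × K₂) x).1 + p₁₂ (WithLp.equiv 2 (K₁ × K₂) x).2,
         p₂₁ (WithLp.equiv 2 (K₁ × K₂) x).1 + p₂₂ (WithLp.equiv 2 (K₁ × K₂) x).2))
    (hpn : ‖p‖ ≤ 1) (a : K₁) (b : K₂) :
    ‖p₁₁ a + p₁₂ b‖ ^ 2 + ‖p₂₁ a + p₂₂ b‖ ^ 2 ≤ ‖a‖ ^ 2 + ‖b‖ ^ 2 := by
  have h := p.le_of_opNorm_le hpn (WithLp.toLp 2 (a, b))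
  have hsq := pow_le_pow_left₀ (norm_nonneg _) h 2
  have hpx : p (WithLp.toLp 2 (a, b)) = WithLp.toLp 2 (p₁₁ a + p₁₂ b, p₂₁ a + p₂₂ b) :=
    (WithLp.equiv 2 (K₁ × K₂)).injective (hp _)
  rw [hpx, one_mul, WithLp.prod_norm_sq_eq_of_L2, WithLp.prod_norm_sq_eq_of_L2] at hsq
  exact hsq


/-- If `p = [[p₁₁,p₁₂],[p₂₁,p₂₂]]` is a bounded operator on the Hilbert-space direct sum
`K₁ ⊕ K₂` with `‖p‖ ≤ 1`, and `X` is a bounded operator on `K₂` with `‖X‖ < 1`,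
then `1 − p₂₂X` is invertible and `‖p₁₁ + p₁₂ X (1 − p₂₂X)⁻¹ p₂₁‖ ≤ 1`. -/
theorem stmt_5 (K₁ K₂ : Type*)
    [NormedAddCommGroup K₁] [InnerProductSpace ℂ K₁] [CompleteSpace K₁]
    [NormedAddCommGroup K₂] [InnerProductSpace ℂ K₂] [CompleteSpace K₂]
    (p : WithLp 2 (K₁ × K₂) →L[ℂ] WithLp 2 (K₁ × K₂))
    (p₁₁ : K₁ →L[ℂ] K₁) (p₁₂ : K₂ →L[ℂ] K₁) (p₂₁ : K₁ →L[ℂ] K₂) (p₂₂ : K₂ →L[ℂ] K₂)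
    (hp : ∀ x : WithLp 2 (K₁ × K₂),
      WithLp.equiv 2 (K₁ × K₂) (p x) =
        (p₁₁ (WithLp.equiv 2 (K₁ × K₂) x).1 + p₁₂ (WithLp.equiv 2 (K₁ × K₂) x).2,
         p₂₁ (WithLp.equiv 2 (K₁ × K₂) x).1 + p₂₂ (WithLp.equiv 2 (K₁ × K₂) x).2))
    (hpn : ‖p‖ ≤ 1)
    (X : K₂ →L[ℂ] K₂) (hX : ‖X‖ < 1) :
    IsUnit (1 - p₂₂.comp X) ∧
      ‖p₁₁ + p₁₂.comp (X.comp ((Ring.inverse (1 - p₂₂.comp X)).comp p₂₁))‖ ≤ 1 := by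
  have key := block_contraction_norm_sq_le hp hpn
  have hp₂₂ : ‖p₂₂‖ ≤ 1 := by
    refine p₂₂.opNorm_le_bound zero_le_one fun b => ?_
    have h := key 0 b
    simp only [map_zero, zero_add, norm_zero] at h
    rw [one_mul]
    exact le_of_pow_le_pow_left₀ two_ne_zero (norm_nonneg _) (by nlinarith [sq_nonneg ‖p₁₂ b‖])
  have hlt : ‖p₂₂.comp X‖ < 1 := by
    refine (p₂₂.opNorm_comp_le X).trans_lt ?_
    nlinarith [norm_nonneg X]
  have hu : IsUnit (1 - p₂₂.comp X) := isUnit_one_sub_of_norm_lt_one hlt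
  refine ⟨hu, ContinuousLinearMap.opNorm_le_bound _ zero_le_one fun k => ?_⟩
  set h := Ring.inverse (1 - p₂₂.comp X) (p₂₁ k) with hh
  have hfix : p₂₁ k + p₂₂ (X h) = h := by
    have e := DFunLike.congr_fun (Ring.mul_inverse_cancel _ hu) (p₂₁ k)
    change h - p₂₂ (X h) = p₂₁ k at e
    rw [← e, sub_add_cancel]
  have hX' : ‖X h‖ ≤ ‖h‖ := by simpa using X.le_of_opNorm_le hX.le h
  have hk := key k (X h)
  rw [hfix] at hk
  rw [one_mul]
  change ‖p₁₁ k + p₁₂ (X h)‖ ≤ ‖k‖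
  refine le_of_pow_le_pow_left₀ two_ne_zero (norm_nonneg _) ?_
  nlinarith [pow_le_pow_left₀ (norm_nonneg _) hX' 2]
end

section
/- Let n ≥ 1 and let X¹, X² ∈ Mₙ(ℂ) be such that 1 − X¹, 1 − X² and 2·1 − X¹ − X² are invertible, and set A = (1 − X¹)⁻¹ + (1 − X²)⁻¹ − 1. Then 1 + A is invertible and (1 + A)⁻¹·(1 − A) = −[ (X¹ + X²)/2 + ((X¹ − X²)/2)·(1 − (X¹ + X²)/2)⁻¹·((X¹ − X²)/2) ]. -/
/-- The sum of the inverses of two units `p`, `q` is `p⁻¹ (p + q) q⁻¹`. -/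
theorem Units.inv_add_inv_eq_mul {R : Type*} [Ring R] (p q : Rˣ) :
    (↑p⁻¹ + ↑q⁻¹ : R) = ↑p⁻¹ * (p + q) * ↑q⁻¹ := by
  simp [mul_add, add_mul, mul_assoc, add_comm]

/-- If `s = p + q` is a unit, then `(q - p) s⁻¹ (q - p) = s - 4 q s⁻¹ p`. -/
theorem Units.sub_mul_inv_mul_sub {R : Type*} [Ring R] (p q : R) (s : Rˣ)
    (hs : (s : R) = p + q) :
    (q - p) * ↑s⁻¹ * (q - p) = s - 4 * (q * ↑s⁻¹ * p) := by
  have hl : q - p = 2 * q - s := by rw [hs]; noncomm_ring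
  have hr : q - p = s - 2 * p := by rw [hs]; noncomm_ring
  calc (q - p) * ↑s⁻¹ * (q - p)
      = (2 * q - s) * ↑s⁻¹ * (s - 2 * p) := by rw [← hl, ← hr]
    _ = 2 * q * (↑s⁻¹ * s) - 4 * (q * ↑s⁻¹ * p) - (s * ↑s⁻¹) * s
          + 2 * ((s * ↑s⁻¹) * p) := by noncomm_ring
    _ = s - 4 * (q * ↑s⁻¹ * p) := by
      rw [Units.inv_mul, Units.mul_inv, hs]; noncomm_ring

/-- If `1 − X¹`, `1 − X²` and `2·1 − X¹ − X²` are invertible matrices and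
`A = (1 − X¹)⁻¹ + (1 − X²)⁻¹ − 1`, then `1 + A` is invertible and
`(1 + A)⁻¹ (1 − A) = −[(X¹+X²)/2 + ((X¹−X²)/2)(1 − (X¹+X²)/2)⁻¹((X¹−X²)/2)]`. -/
theorem stmt_12 (n : ℕ) (hn : 1 ≤ n) (X₁ X₂ : Matrix (Fin n) (Fin n) ℂ)
    (h1 : IsUnit (1 - X₁)) (h2 : IsUnit (1 - X₂))
    (h3 : IsUnit ((2 : Matrix (Fin n) (Fin n) ℂ) - X₁ - X₂)) :
    let A : Matrix (Fin n) (Fin n) ℂ := (1 - X₁)⁻¹ + (1 - X₂)⁻¹ - 1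
    IsUnit (1 + A) ∧
      (1 + A)⁻¹ * (1 - A) =
        -((2 : ℂ)⁻¹ • (X₁ + X₂) +
          ((2 : ℂ)⁻¹ • (X₁ - X₂)) * (1 - (2 : ℂ)⁻¹ • (X₁ + X₂))⁻¹ *
            ((2 : ℂ)⁻¹ • (X₁ - X₂))) := by
  intro A
  obtain ⟨p, hp⟩ := h1
  obtain ⟨q, hq⟩ := h2
  obtain ⟨s, hs⟩ := h3
  have hX₁ : X₁ = 1 - p := by rw [hp]; abel
  have hX₂ : X₂ = 1 - q := by rw [hq]; abel
  have hspq : s.val = p + q := by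
    rw [hs, hp, hq, ← one_add_one_eq_two]; abel
  have hA : 1 + A = ↑(p⁻¹ * s * q⁻¹) := by
    simp only [A, ← hp, ← hq, ← Matrix.coe_units_inv, Units.val_mul, hspq,
      ← Units.inv_add_inv_eq_mul]
    abel
  have hinv : (1 + A)⁻¹ = q.val * s⁻¹.val * p.val := by
    rw [hA, ← Matrix.coe_units_inv]
    simp only [mul_inv_rev, inv_inv, Units.val_mul, mul_assoc]
  have hcancel : (1 + A)⁻¹ * (1 + A) = 1 := by
    rw [hA, ← Matrix.coe_units_inv, Units.inv_mul]
  have hmean : (2 : ℂ)⁻¹ • (X₁ + X₂) = 1 - (2 : ℂ)⁻¹ • s.val := by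
    rw [hX₁, hX₂, hspq]; module
  have hdiff : X₁ - X₂ = q - p := by rw [hX₁, hX₂]; abel
  have hmeanInv : (1 - (2 : ℂ)⁻¹ • (X₁ + X₂))⁻¹ =
      (2 : ℂ) • s⁻¹.val := by
    apply Matrix.inv_eq_right_inv
    rw [hmean, sub_sub_cancel, smul_mul_smul_comm, Units.mul_inv]
    norm_num
  refine ⟨hA ▸ Units.isUnit _, ?_⟩
  have hlhs : (1 + A)⁻¹ * (1 - A) = (2 : ℂ) • (q.val * s⁻¹.val * p.val) - 1 := by
    have h : 1 - A = (2 : ℂ) • (1 : Matrix (Fin n) (Fin n) ℂ) - (1 + A) := by module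
    rw [h, mul_sub, hcancel, mul_smul_comm, mul_one, hinv]
  have hfour (M : Matrix (Fin n) (Fin n) ℂ) : 4 * M = (4 : ℂ) • M := by
    rw [ofNat_smul_eq_nsmul ℂ 4 M, nsmul_eq_mul]; rfl
  rw [hlhs, hmeanInv, hmean, hdiff]
  simp only [smul_mul_assoc, mul_smul_comm]
  rw [Units.sub_mul_inv_mul_sub _ _ s hspq, hfour]
  module
end

section
/- Let p, q, r ≥ 1. Let A be a (p+q) × (p+q) complex matrix with block decomposition A = [[A₁₁, A₁₂], [A₂₁, A₂₂]] (A₁₁ ∈ M_p(ℂ), A₂₂ ∈ M_q(ℂ)), let B be an (r+p) × (r+p) complex matrix with block decomposition B = [[B₁₁, B₁₂], [B₂₁, B₂₂]] (B₁₁ ∈ M_r(ℂ), B₂₂ ∈ M_p(ℂ)), and let X ∈ M_q(ℂ). Assume 1 − A₁₁B₂₂, 1 − B₂₂A₁₁, 1 − A₂₂X, 1 − B₂₂·F^u_A(X) and 1 − (B∗A)₂₂·X are invertible, where F^u_A(X) = A₁₁ + A₁₂X(1 − A₂₂X)⁻¹A₂₁ and the Redheffer product B∗A is the (r+q) × (r+q)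 block matrix B∗A = [[B₁₁ + B₁₂A₁₁(1 − B₂₂A₁₁)⁻¹B₂₁, B₁₂(1 − A₁₁B₂₂)⁻¹A₁₂], [A₂₁(1 − B₂₂A₁₁)⁻¹B₂₁, A₂₂ + A₂₁B₂₂(1 − A₁₁B₂₂)⁻¹A₁₂]]. Then F^u_{B∗A}(X) = F^u_B(F^u_A(X)). -/
/-- The rational identity behind the composition law, with the inverses replaced by matrices
`M`, `L`, `N`, `R`, `S` satisfying the one-sided inverse relations that are needed. -/
theorem redheffer_core {R₀ m n : Type*} [Ring R₀] [Fintype m] [Fintype n] [DecidableEq m]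
    [DecidableEq n] (A₁₁ B₂₂ M L S : Matrix m m R₀) (A₁₂ : Matrix m n R₀)
    (A₂₁ : Matrix n m R₀) (A₂₂ X N R : Matrix n n R₀)
    (hM : (1 - A₁₁ * B₂₂) * M = 1) (hL : L * (1 - B₂₂ * A₁₁) = 1)
    (hN : (1 - A₂₂ * X) * N = 1)
    (hR : R * (1 - (A₂₂ + A₂₁ * B₂₂ * M * A₁₂) * X) = 1)
    (hS : (1 - B₂₂ * (A₁₁ + A₁₂ * X * N * A₂₁)) * S = 1) :
    A₁₁ * L + M * A₁₂ * X * R * A₂₁ * L = (A₁₁ + A₁₂ * X * N * A₂₁) * S := by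
  have hLB : L * B₂₂ = B₂₂ * M := by
    calc L * B₂₂ = L * B₂₂ * ((1 - A₁₁ * B₂₂) * M) := by rw [hM, mul_one]
      _ = L * (1 - B₂₂ * A₁₁) * (B₂₂ * M) := by noncomm_ring
      _ = B₂₂ * M := by rw [hL, one_mul]
  have hLF : L * (1 - B₂₂ * (A₁₁ + A₁₂ * X * N * A₂₁)) =
      1 - B₂₂ * M * (A₁₂ * X * N * A₂₁) := by
    calc _ = L * (1 - B₂₂ * A₁₁) - L * B₂₂ * (A₁₂ * X * N * A₂₁) := by
          generalize A₁₂ * X * N * A₂₁ = G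
          noncomm_ring
      _ = _ := by rw [hL, hLB]
  have hRN : R * (1 - A₂₁ * B₂₂ * M * A₁₂ * X * N) = N := by
    calc R * (1 - A₂₁ * B₂₂ * M * A₁₂ * X * N)
        = R * ((1 - A₂₂ * X) * N - A₂₁ * B₂₂ * M * A₁₂ * X * N) := by rw [hN]
      _ = R * (1 - (A₂₂ + A₂₁ * B₂₂ * M * A₁₂) * X) * N := by
        generalize A₂₁ * B₂₂ * M * A₁₂ = T
        noncomm_ring
      _ = N := by rw [hR, one_mul]
  have key : (A₁₁ * L + M * A₁₂ * X * R * A₂₁ * L) *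
      (1 - B₂₂ * (A₁₁ + A₁₂ * X * N * A₂₁)) = A₁₁ + A₁₂ * X * N * A₂₁ := by
    calc _ = (A₁₁ + M * A₁₂ * X * R * A₂₁) *
          (L * (1 - B₂₂ * (A₁₁ + A₁₂ * X * N * A₂₁))) := by
          rw [← Matrix.mul_assoc, Matrix.add_mul A₁₁]
      _ = A₁₁ - A₁₁ * B₂₂ * M * (A₁₂ * X * N * A₂₁) +
          M * A₁₂ * X * (R * (1 - A₂₁ * B₂₂ * M * A₁₂ * X * N)) * A₂₁ := by
          rw [hLF]
          simp only [Matrix.mul_sub, Matrix.sub_mul, Matrix.add_mul, Matrix.mul_assoc,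
            Matrix.mul_one]
          abel
      _ = A₁₁ + (1 - A₁₁ * B₂₂) * M * (A₁₂ * X * N * A₂₁) := by
          rw [hRN]
          simp only [Matrix.sub_mul, Matrix.mul_assoc, Matrix.one_mul]
          abel
      _ = _ := by rw [hM, Matrix.one_mul]
  conv_rhs => rw [← key, Matrix.mul_assoc, hS, Matrix.mul_one]

/-- The Redheffer product composes upper linear fractional transforms:
`F^u_{B∗A}(X) = F^u_B(F^u_A(X))`, under the stated invertibility hypotheses,
where `F^u_P(X) = P₁₁ + P₁₂ X (1 − P₂₂X)⁻¹ P₂₁`, and the Redheffer product `B∗A`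
has blocks `(B∗A)₁₁ = F^u_B(A₁₁)`, `(B∗A)₁₂ = B₁₂(1 − A₁₁B₂₂)⁻¹A₁₂`,
`(B∗A)₂₁ = A₂₁(1 − B₂₂A₁₁)⁻¹B₂₁`, `(B∗A)₂₂ = F^ℓ_A(B₂₂) = A₂₂ + A₂₁B₂₂(1 − A₁₁B₂₂)⁻¹A₁₂`. -/
theorem stmt_14 (p q r : ℕ) (hp : 1 ≤ p) (hq : 1 ≤ q) (hr : 1 ≤ r)
    (A₁₁ : Matrix (Fin p) (Fin p) ℂ) (A₁₂ : Matrix (Fin p) (Fin q) ℂ)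
    (A₂₁ : Matrix (Fin q) (Fin p) ℂ) (A₂₂ : Matrix (Fin q) (Fin q) ℂ)
    (B₁₁ : Matrix (Fin r) (Fin r) ℂ) (B₁₂ : Matrix (Fin r) (Fin p) ℂ)
    (B₂₁ : Matrix (Fin p) (Fin r) ℂ) (B₂₂ : Matrix (Fin p) (Fin p) ℂ)
    (X : Matrix (Fin q) (Fin q) ℂ)
    (h1 : IsUnit (1 - A₁₁ * B₂₂)) (h2 : IsUnit (1 - B₂₂ * A₁₁))
    (h3 : IsUnit (1 - A₂₂ * X))
    (h4 : IsUnit (1 - B₂₂ * (A₁₁ + A₁₂ * X * (1 - A₂₂ * X)⁻¹ * A₂₁)))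
    (h5 : IsUnit (1 - (A₂₂ + A₂₁ * B₂₂ * (1 - A₁₁ * B₂₂)⁻¹ * A₁₂) * X)) :
    (B₁₁ + B₁₂ * A₁₁ * (1 - B₂₂ * A₁₁)⁻¹ * B₂₁) +
      (B₁₂ * (1 - A₁₁ * B₂₂)⁻¹ * A₁₂) * X *
        (1 - (A₂₂ + A₂₁ * B₂₂ * (1 - A₁₁ * B₂₂)⁻¹ * A₁₂) * X)⁻¹ *
          (A₂₁ * (1 - B₂₂ * A₁₁)⁻¹ * B₂₁) =
      B₁₁ + B₁₂ * (A₁₁ + A₁₂ * X * (1 - A₂₂ * X)⁻¹ * A₂₁) *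
        (1 - B₂₂ * (A₁₁ + A₁₂ * X * (1 - A₂₂ * X)⁻¹ * A₂₁))⁻¹ * B₂₁ := by
  rw [Matrix.isUnit_iff_isUnit_det] at h1 h2 h3 h4 h5
  have h := redheffer_core A₁₁ B₂₂ _ _ _ A₁₂ A₂₁ A₂₂ X _ _
    (Matrix.mul_nonsing_inv _ h1) (Matrix.nonsing_inv_mul _ h2) (Matrix.mul_nonsing_inv _ h3)
    (Matrix.nonsing_inv_mul _ h5) (Matrix.mul_nonsing_inv _ h4)
  rw [Matrix.mul_assoc B₁₂ (A₁₁ + _), ← h]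
  simp only [Matrix.mul_add, Matrix.add_mul, Matrix.mul_assoc, add_assoc]
end
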